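/- Under Assumption 2.3 (with z_{v₀,e₀} and z_{v₁,e₀} finite), for every γ ∈ ℝ the relative entropy of Π^{γφ} with respect to ℙ_{v₀,v₁,e₀} satisfies E_{Π^{γφ}}[ log( dΠ^{γφ}/dℙ_{v₀,v₁,e₀} ) ] ≤ S_φ·γ²/2, where S_φ := ∑_{v∈V} ((a_v+1)/2) · max_{e,e'∈E: v∈e, v∈e'} (φ(e) − φ(e'))². -/

import Mathlib

open MeasureTheory
open scoped ENNReal Classical

namespace ERRWGraph

noncomputable section

variable {V : Type*} [Fintype V] [DecidableEq V]

/-- The measure `dx/x` on `(0,∞)`, i.e. Lebesgue measure on a logarithmic scale. -/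
def logMeasure : Measure ℝ :=
  (volume.restrict (Set.Ioi (0 : ℝ))).withDensity fun x => ENNReal.ofReal (1 / x)

variable (G : SimpleGraph V) [Fintype G.edgeSet]

/-- The set `Ω_{e₀}` of strictly positive edge weights normalized at the reference
edge `e₀`. -/
def Omega (e₀ : G.edgeSet) : Set (G.edgeSet → ℝ) :=
  {x | (∀ e, 0 < x e) ∧ x e₀ = 1}

/-- The reference measure `ρ_{e₀} = δ₁(dx_{e₀}) ∏_{e ≠ e₀} dx_e/x_e`, realized as a
measure on `(0,∞)^E ⊆ ℝ^E` concentrated on `Ω_{e₀}`. -/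
def rho (e₀ : G.edgeSet) : Measure (G.edgeSet → ℝ) :=
  Measure.pi fun e => if e = e₀ then Measure.dirac 1 else logMeasure

/-- Vertex weight `x_v = ∑_{e ∋ v} x_e`. -/
def vwt (x : G.edgeSet → ℝ) (v : V) : ℝ :=
  ∑ e : G.edgeSet, if v ∈ (e : Sym2 V) then x e else 0

/-- Vertex weight `a_v = ∑_{e ∋ v} a_e` of the initial weights `a : Sym2 V → ℝ`. -/
def avwt (a : Sym2 V → ℝ) (v : V) : ℝ :=
  ∑ e : G.edgeSet, if v ∈ (e : Sym2 V) then a (e : Sym2 V) else 0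

/-- A set `T` of edges of `G` is a spanning tree iff the graph with edge set `T`
is a tree (i.e. a maximal connected acyclic subgraph of `G`). -/
def IsSpanningTree (T : Finset G.edgeSet) : Prop :=
  (SimpleGraph.fromEdgeSet (Subtype.val '' (T : Set G.edgeSet))).IsTree

/-- `∑_{T ∈ 𝒯} ∏_{e ∈ T} x_e`, the sum over spanning trees of `G`. -/
def treeSum (x : G.edgeSet → ℝ) : ℝ :=
  ∑ T : Finset G.edgeSet, if IsSpanningTree G T then (∏ e ∈ T, x e) else 0

/-- The function `Φ_{v₀,a}` from the Coppersmith–Diaconis description of the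
mixing measure. -/
def Phi (a : Sym2 V → ℝ) (v₀ : V) (x : G.edgeSet → ℝ) : ℝ :=
  (∏ e : G.edgeSet, x e ^ a (e : Sym2 V)) * vwt G x v₀ ^ (-avwt G a v₀ / 2) *
    (∏ v ∈ Finset.univ.erase v₀, vwt G x v ^ (-(avwt G a v + 1) / 2)) *
    Real.sqrt (treeSum G x)

/-- The normalizing constant `z_{v₀,e₀} = ∫ Φ_{v₀,a} dρ_{e₀}`. -/
def z (a : Sym2 V → ℝ) (v₀ : V) (e₀ : G.edgeSet) : ℝ≥0∞ :=
  ∫⁻ x, ENNReal.ofReal (Phi G a v₀ x) ∂rho G e₀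

/-- The mixing measure `ℚ_{v₀,e₀}`, with density `Φ_{v₀,a}/z_{v₀,e₀}` w.r.t. `ρ_{e₀}`. -/
def Qm (a : Sym2 V → ℝ) (v₀ : V) (e₀ : G.edgeSet) : Measure (G.edgeSet → ℝ) :=
  (z G a v₀ e₀)⁻¹ • (rho G e₀).withDensity fun x => ENNReal.ofReal (Phi G a v₀ x)

/-- The density `((Φ_{v₀,a}/z_{v₀,e₀})·(Φ_{v₁,a}/z_{v₁,e₀}))^{1/2}` of the
interpolated measure. -/
def interpDens (a : Sym2 V → ℝ) (v₀ v₁ : V) (e₀ : G.edgeSet) (x : G.edgeSet → ℝ) : ℝ≥0∞ :=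
  (ENNReal.ofReal (Phi G a v₀ x) / z G a v₀ e₀ *
    (ENNReal.ofReal (Phi G a v₁ x) / z G a v₁ e₀)) ^ (1 / 2 : ℝ)

/-- The normalizing constant `Z_{v₀,v₁,e₀}` of the interpolated measure. -/
def Zc (a : Sym2 V → ℝ) (v₀ v₁ : V) (e₀ : G.edgeSet) : ℝ≥0∞ :=
  ∫⁻ x, interpDens G a v₀ v₁ e₀ x ∂rho G e₀

/-- The interpolated measure `ℙ_{v₀,v₁,e₀}`. -/
def Pm (a : Sym2 V → ℝ) (v₀ v₁ : V) (e₀ : G.edgeSet) : Measure (G.edgeSet → ℝ) :=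
  (Zc G a v₀ v₁ e₀)⁻¹ • (rho G e₀).withDensity (interpDens G a v₀ v₁ e₀)

/-- `f` is an automorphism of the weighted graph `(G,a)`. -/
def IsAut (a : Sym2 V → ℝ) (f : V → V) : Prop :=
  Function.Bijective f ∧ (∀ u v : V, G.Adj (f u) (f v) ↔ G.Adj u v) ∧
    ∀ u v : V, G.Adj u v → a s(f u, f v) = a s(u, v)

/-- Assumption 2.3 of the paper. -/
def Assumption23 (a φ : Sym2 V → ℝ) (v₀ v₁ : V) (e₀ : G.edgeSet) : Prop :=
  v₀ ≠ v₁ ∧ ¬G.Adj v₀ v₁ ∧ v₀ ∈ (e₀ : Sym2 V) ∧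
    (∃ f : V → V, IsAut G a f ∧ f v₀ = v₁ ∧ f v₁ = v₀) ∧
    (∀ e : G.edgeSet, φ (e : Sym2 V) ∈ Set.Icc (0 : ℝ) 1) ∧
    (∀ e : G.edgeSet, v₀ ∈ (e : Sym2 V) → φ (e : Sym2 V) = 0) ∧
    (∀ e : G.edgeSet, v₁ ∈ (e : Sym2 V) → φ (e : Sym2 V) = 1)

/-- `max_{e,e' ∋ v} (φ(e) - φ(e'))²`. -/
def maxsq (φ : Sym2 V → ℝ) (v : V) : ℝ :=
  sSup ((fun p : G.edgeSet × G.edgeSet =>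
      (φ (p.1 : Sym2 V) - φ (p.2 : Sym2 V)) ^ 2) ''
    {p : G.edgeSet × G.edgeSet | v ∈ (p.1 : Sym2 V) ∧ v ∈ (p.2 : Sym2 V)})

/-- The "Dirichlet form" `S_φ`. -/
def Sphi (a φ : Sym2 V → ℝ) : ℝ :=
  ∑ v : V, (avwt G a v + 1) / 2 * maxsq G φ v

/-- `H_{v₀,v₁}(x) = (1/4) log (x_{v₁}/x_{v₀})`. -/
def Hfun (v₀ v₁ : V) (x : G.edgeSet → ℝ) : ℝ :=
  (1 / 4) * Real.log (vwt G x v₁ / vwt G x v₀)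

/-- `log (dQ/dP)` realized via the Radon–Nikodym derivative. -/
def logRN {α : Type*} [MeasurableSpace α] (Q P : Measure α) (x : α) : ℝ :=
  Real.log ((Q.rnDeriv P x).toReal)

/-- The deformation map `Ξ^{γφ}(x) = (e^{γφ(e)} x_e)_{e∈E}`. -/
def Xi (φ : Sym2 V → ℝ) (γ : ℝ) (x : G.edgeSet → ℝ) : G.edgeSet → ℝ :=
  fun e => Real.exp (γ * φ (e : Sym2 V)) * x e

/-- `Π^{γφ}`, the image of `ℙ_{v₀,v₁,e₀}` under `Ξ^{γφ}`. -/
def PiGamma (a φ : Sym2 V → ℝ) (v₀ v₁ : V) (e₀ : G.edgeSet) (γ : ℝ) :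
    Measure (G.edgeSet → ℝ) :=
  Measure.map (Xi G φ γ) (Pm G a v₀ v₁ e₀)

/-- The explicit realization `f_γ` of `log(dΠ^{γφ}/dℙ_{v₀,v₁,e₀}) ∘ Ξ^{γφ}`. -/
def fgamma (a φ : Sym2 V → ℝ) (v₀ v₁ : V) (γ : ℝ) (x : G.edgeSet → ℝ) : ℝ :=
  γ * (avwt G a v₁ / 2 + 1 / 4) -
    γ * ∑ e : G.edgeSet, φ (e : Sym2 V) * a (e : Sym2 V) +
    (∑ v ∈ Finset.univ \ {v₀, v₁}, (avwt G a v + 1) / 2 *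
      Real.log (vwt G (Xi G φ γ x) v / vwt G x v)) -
    (1 / 2) * Real.log (treeSum G (Xi G φ γ x) / treeSum G x)

/-- Mean of `φ` under the measure `μ_{x,v,γ}` on the edges incident to `v`. -/
def muMean (φ : Sym2 V → ℝ) (γ : ℝ) (x : G.edgeSet → ℝ) (v : V) : ℝ :=
  (∑ e : G.edgeSet, if v ∈ (e : Sym2 V) then φ (e : Sym2 V) * Xi G φ γ x e else 0) /
    vwt G (Xi G φ γ x) v

/-- Variance of `φ` under `μ_{x,v,γ}`. -/
def muVar (φ : Sym2 V → ℝ) (γ : ℝ) (x : G.edgeSet → ℝ) (v : V) : ℝ :=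
  (∑ e : G.edgeSet, if v ∈ (e : Sym2 V) then
      (φ (e : Sym2 V) - muMean G φ γ x v) ^ 2 * Xi G φ γ x e else 0) /
    vwt G (Xi G φ γ x) v

/-- `Δ(T) = ∑_{e ∈ T} φ(e)`. -/
def Delta (φ : Sym2 V → ℝ) (T : Finset G.edgeSet) : ℝ := ∑ e ∈ T, φ (e : Sym2 V)

/-- Mean of `Δ` under the measure `ν_{x,γ}` on spanning trees. -/
def nuMean (φ : Sym2 V → ℝ) (γ : ℝ) (x : G.edgeSet → ℝ) : ℝ :=
  (∑ T : Finset G.edgeSet, if IsSpanningTree G T then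
      Delta G φ T * ∏ e ∈ T, Xi G φ γ x e else 0) /
    treeSum G (Xi G φ γ x)

/-- Variance of `Δ` under `ν_{x,γ}`. -/
def nuVar (φ : Sym2 V → ℝ) (γ : ℝ) (x : G.edgeSet → ℝ) : ℝ :=
  (∑ T : Finset G.edgeSet, if IsSpanningTree G T then
      (Delta G φ T - nuMean G φ γ x) ^ 2 * ∏ e ∈ T, Xi G φ γ x e else 0) /
    treeSum G (Xi G φ γ x)

/-- The claimed first derivative of `γ ↦ f_γ(x)`. -/
def fder1 (a φ : Sym2 V → ℝ) (v₀ v₁ : V) (x : G.edgeSet → ℝ) (γ : ℝ) : ℝ :=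
  avwt G a v₁ / 2 + 1 / 4 - (∑ e : G.edgeSet, φ (e : Sym2 V) * a (e : Sym2 V)) +
    (∑ v ∈ Finset.univ \ {v₀, v₁}, (avwt G a v + 1) / 2 * muMean G φ γ x v) -
    (1 / 2) * nuMean G φ γ x

/-- The claimed second derivative of `γ ↦ f_γ(x)`. -/
def fder2 (a φ : Sym2 V → ℝ) (v₀ v₁ : V) (x : G.edgeSet → ℝ) (γ : ℝ) : ℝ :=
  (∑ v ∈ Finset.univ \ {v₀, v₁}, (avwt G a v + 1) / 2 * muVar G φ γ x v) -
    (1 / 2) * nuVar G φ γ x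

/-- Membership in the class `𝒫` of the variational principle. -/
def VarP (a : Sym2 V → ℝ) (v₀ v₁ : V) (e₀ : G.edgeSet)
    (Q : Measure (G.edgeSet → ℝ)) : Prop :=
  IsProbabilityMeasure Q ∧ Q ≪ Pm G a v₀ v₁ e₀ ∧ Pm G a v₀ v₁ e₀ ≪ Q ∧
    Integrable (Hfun G v₀ v₁) Q ∧ Integrable (logRN Q (Pm G a v₀ v₁ e₀)) Q

/-- The functional `F(Π) = E_Π[H] + E_Π[log(dΠ/dℙ_{v₀,v₁,e₀})]`. -/
def Ffun (a : Sym2 V → ℝ) (v₀ v₁ : V) (e₀ : G.edgeSet)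
    (Q : Measure (G.edgeSet → ℝ)) : ℝ :=
  (∫ x, Hfun G v₀ v₁ x ∂Q) + ∫ x, logRN Q (Pm G a v₀ v₁ e₀) x ∂Q

end

end ERRWGraph

namespace ERRWGraph

section FiniteTilting

variable {ι : Type*} [Fintype ι] (w φ : ι → ℝ) (γ : ℝ)

/-- The mean of `φ` under the probability weights proportional to `w`. -/
noncomputable def weightedMean : ℝ := (∑ i, w i * φ i) / ∑ i, w i

variable {w}

lemma abs_weightedMean_le (hw : ∀ i, 0 ≤ w i) :
    |weightedMean w φ| ≤ ∑ i, |φ i| := by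
  have hC : (0 : ℝ) ≤ ∑ i, |φ i| := Finset.sum_nonneg fun i _ => abs_nonneg _
  have hS : 0 ≤ ∑ i, w i := Finset.sum_nonneg fun i _ => hw i
  rw [weightedMean, abs_div, abs_of_nonneg hS]
  refine div_le_of_le_mul₀ hS hC ((Finset.abs_sum_le_sum_abs _ _).trans ?_)
  rw [Finset.mul_sum]
  refine Finset.sum_le_sum fun i _ => ?_
  rw [abs_mul, abs_of_nonneg (hw i), mul_comm]
  exact mul_le_mul_of_nonneg_right
    (Finset.single_le_sum (f := fun i => |φ i|) (fun i _ => abs_nonneg _)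
      (Finset.mem_univ i)) (hw i)

lemma sum_mul_exp_pos (hw : ∀ i, 0 ≤ w i) (hS : 0 < ∑ i, w i) :
    0 < ∑ i, w i * Real.exp (γ * φ i) := by
  obtain ⟨i, -, hi⟩ := Finset.exists_lt_of_sum_lt (s := Finset.univ) (f := fun _ => (0 : ℝ))
    (g := w) (by simpa using hS)
  exact Finset.sum_pos' (fun j _ => mul_nonneg (hw j) (Real.exp_pos _).le)
    ⟨i, Finset.mem_univ i, mul_pos hi (Real.exp_pos _)⟩

lemma mul_exp_weightedMean_le (hw : ∀ i, 0 ≤ w i) (hS : 0 < ∑ i, w i) :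
    (∑ i, w i) * Real.exp (γ * weightedMean w φ) ≤ ∑ i, w i * Real.exp (γ * φ i) := by
  set m := weightedMean w φ with hm
  have hmS : m * ∑ i, w i = ∑ i, w i * φ i := by
    rw [hm, weightedMean, div_mul_cancel₀ _ hS.ne']
  have hle : ∑ i, w i * (Real.exp (γ * m) * (γ * φ i - γ * m + 1)) ≤
      ∑ i, w i * Real.exp (γ * φ i) := by
    refine Finset.sum_le_sum fun i _ => mul_le_mul_of_nonneg_left ?_ (hw i)
    calc Real.exp (γ * m) * (γ * φ i - γ * m + 1)
        ≤ Real.exp (γ * m) * Real.exp (γ * φ i - γ * m) :=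
          mul_le_mul_of_nonneg_left (Real.add_one_le_exp _) (Real.exp_pos _).le
      _ = Real.exp (γ * φ i) := by rw [← Real.exp_add]; congr 1; ring
  refine le_trans (le_of_eq ?_) hle
  have : ∀ i, w i * (Real.exp (γ * m) * (γ * φ i - γ * m + 1)) =
      Real.exp (γ * m) * γ * (w i * φ i) + Real.exp (γ * m) * (1 - γ * m) * w i := fun i => by ring
  simp_rw [this, Finset.sum_add_distrib, ← Finset.mul_sum]
  rw [← hmS]
  ring

/-- Jensen's inequality for the logarithm of a tilted sum. -/
lemma mul_weightedMean_le_log (hw : ∀ i, 0 ≤ w i) (hS : 0 < ∑ i, w i) :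
    γ * weightedMean w φ ≤ Real.log (∑ i, w i * Real.exp (γ * φ i)) - Real.log (∑ i, w i) := by
  have h := Real.log_le_log (by positivity) (mul_exp_weightedMean_le φ γ hw hS)
  rw [Real.log_mul hS.ne' (Real.exp_pos _).ne', Real.log_exp] at h
  linarith

/-- A Hoeffding-type bound for the logarithm of a tilted sum. -/
lemma log_le_mul_weightedMean_add (hw : ∀ i, 0 ≤ w i) (hS : 0 < ∑ i, w i) {D : ℝ}
    (hD : ∀ i j, w i ≠ 0 → w j ≠ 0 → (φ i - φ j) ^ 2 ≤ D) :
    Real.log (∑ i, w i * Real.exp (γ * φ i)) - Real.log (∑ i, w i) ≤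
      γ * weightedMean w φ + D * γ ^ 2 / 2 := by
  have hpos := sum_mul_exp_pos φ γ hw hS
  have hneg := sum_mul_exp_pos φ (-γ) hw hS
  have hprod : (∑ i, w i * Real.exp (γ * φ i)) * (∑ j, w j * Real.exp (-γ * φ j)) ≤
      (∑ i, w i) * (∑ j, w j) * Real.exp (D * γ ^ 2 / 2) := by
    have hcosh : (∑ i, w i * Real.exp (γ * φ i)) * (∑ j, w j * Real.exp (-γ * φ j)) =
        ∑ i, ∑ j, w i * w j * Real.cosh (γ * (φ i - φ j)) := by
      have h1 : (∑ i, w i * Real.exp (γ * φ i)) * (∑ j, w j * Real.exp (-γ * φ j)) =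
          ∑ i, ∑ j, w i * w j * Real.exp (γ * (φ i - φ j)) := by
        rw [Finset.sum_mul_sum]
        refine Finset.sum_congr rfl fun i _ => Finset.sum_congr rfl fun j _ => ?_
        rw [mul_mul_mul_comm, ← Real.exp_add]
        congr 2; ring
      have h2 : ∑ i, ∑ j, w i * w j * Real.exp (γ * (φ i - φ j)) =
          ∑ i, ∑ j, w i * w j * Real.exp (-(γ * (φ i - φ j))) := by
        rw [Finset.sum_comm]
        refine Finset.sum_congr rfl fun i _ => Finset.sum_congr rfl fun j _ => ?_
        rw [mul_comm (w j)]
        congr 2; ring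
      have h3 : ∀ i j, w i * w j * Real.cosh (γ * (φ i - φ j)) =
          (w i * w j * Real.exp (γ * (φ i - φ j)) +
            w i * w j * Real.exp (-(γ * (φ i - φ j)))) / 2 := fun i j => by
        rw [Real.cosh_eq]; ring
      simp_rw [h3, ← Finset.sum_div, Finset.sum_add_distrib]
      rw [← h2, h1]
      ring
    rw [hcosh, Finset.sum_mul_sum, Finset.sum_mul]
    refine Finset.sum_le_sum fun i _ => ?_
    rw [Finset.sum_mul]
    refine Finset.sum_le_sum fun j _ => ?_
    rcases eq_or_ne (w i) 0 with hi | hi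
    · simp [hi]
    rcases eq_or_ne (w j) 0 with hj | hj
    · simp [hj]
    refine mul_le_mul_of_nonneg_left ((Real.cosh_le_exp_half_sq _).trans ?_)
      (mul_nonneg (hw i) (hw j))
    rw [Real.exp_le_exp, mul_pow]
    nlinarith [hD i j hi hj, sq_nonneg γ]
  have h := Real.log_le_log (mul_pos hpos hneg) hprod
  rw [Real.log_mul hpos.ne' hneg.ne', Real.log_mul (by positivity) (Real.exp_pos _).ne',
    Real.log_mul hS.ne' hS.ne', Real.log_exp] at h
  have hJ := mul_weightedMean_le_log φ (-γ) hw hS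
  linarith

end FiniteTilting

section GibbsFlow

variable {α : Type*} [MeasurableSpace α] {ρ : Measure α} {L : α → ℝ} {T S : α → α}

/-- Image of a Gibbs measure under an invertible transformation preserving the reference
measure. -/
lemma map_withDensity_exp (hL : Measurable L) (hT : MeasurePreserving T ρ ρ) (hS : Measurable S)
    (hST : ∀ x, S (T x) = x) :
    (ρ.withDensity fun x => ENNReal.ofReal (Real.exp (L x))).map T =
      (ρ.withDensity fun x => ENNReal.ofReal (Real.exp (L x))).withDensity
        fun y => ENNReal.ofReal (Real.exp (L (S y) - L y)) := by
  rw [← withDensity_mul _ (by fun_prop) (by fun_prop)]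
  have hmul : ((fun x => ENNReal.ofReal (Real.exp (L x))) *
      fun y => ENNReal.ofReal (Real.exp (L (S y) - L y))) =
      fun y => ENNReal.ofReal (Real.exp (L (S y))) := by
    ext y
    rw [Pi.mul_apply, ← ENNReal.ofReal_mul (Real.exp_pos _).le, ← Real.exp_add]
    congr 2; ring
  rw [hmul]
  ext s hs
  rw [Measure.map_apply hT.measurable hs, withDensity_apply _ (hT.measurable hs),
    withDensity_apply _ hs,
    ← hT.setLIntegral_comp_preimage hs
      (f := fun y => ENNReal.ofReal (Real.exp (L (S y)))) (by fun_prop)]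
  simp_rw [hST]

/-- The relative entropy of the image of a Gibbs measure. -/
lemma integral_log_rnDeriv_map_exp {P : Measure α} [IsFiniteMeasure P]
    (hP : P = ρ.withDensity fun x => ENNReal.ofReal (Real.exp (L x)))
    (hL : Measurable L) (hT : MeasurePreserving T ρ ρ) (hS : Measurable S)
    (hST : ∀ x, S (T x) = x) :
    ∫ x, Real.log (((P.map T).rnDeriv P x).toReal) ∂P.map T = ∫ x, (L x - L (T x)) ∂P := by
  have hmap : P.map T = P.withDensity fun y => ENNReal.ofReal (Real.exp (L (S y) - L y)) := by
    rw [hP]; exact map_withDensity_exp hL hT hS hST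
  have hmeas : Measurable fun y => ENNReal.ofReal (Real.exp (L (S y) - L y)) := by fun_prop
  have hrn : (P.map T).rnDeriv P =ᵐ[P.map T]
      fun y => ENNReal.ofReal (Real.exp (L (S y) - L y)) := by
    have h := Measure.rnDeriv_withDensity P hmeas
    rw [← hmap] at h
    refine Measure.AbsolutelyContinuous.ae_eq ?_ h
    rw [hmap]
    exact withDensity_absolutelyContinuous _ _
  have hlog : (fun y => Real.log (((P.map T).rnDeriv P y).toReal)) =ᵐ[P.map T]
      fun y => L (S y) - L y := by
    filter_upwards [hrn] with y hy
    rw [hy, ENNReal.toReal_ofReal (Real.exp_pos _).le, Real.log_exp]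
  rw [integral_congr_ae hlog, integral_map hT.measurable.aemeasurable
    (by fun_prop : Measurable fun y => L (S y) - L y).aestronglyMeasurable]
  simp_rw [hST]

lemma lintegral_exp_sub_eq_one {P : Measure α} [IsProbabilityMeasure P]
    (hP : P = ρ.withDensity fun x => ENNReal.ofReal (Real.exp (L x)))
    (hL : Measurable L) (hT : MeasurePreserving T ρ ρ) :
    ∫⁻ x, ENNReal.ofReal (Real.exp (L (T x) - L x)) ∂P = 1 := by
  have hTm := hT.measurable
  have hone : ∫⁻ x, ENNReal.ofReal (Real.exp (L x)) ∂ρ = 1 := by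
    have h : P Set.univ = 1 := measure_univ
    rwa [hP, withDensity_apply _ MeasurableSet.univ, Measure.restrict_univ] at h
  rw [hP, lintegral_withDensity_eq_lintegral_mul _ (by fun_prop) (by fun_prop), ← hone,
    ← hT.lintegral_comp (f := fun x => ENNReal.ofReal (Real.exp (L x))) (by fun_prop)]
  refine lintegral_congr fun x => ?_
  rw [Pi.mul_apply, ← ENNReal.ofReal_mul (Real.exp_pos _).le, ← Real.exp_add]
  congr 2; ring

/-- If `F γ` are the negative logarithms of probability densities that are quadratically close
to `γ * g`, then `g` has mean zero and the mean of `F γ` is at most quadratic. -/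
lemma integral_le_of_quadratic_bound {P : Measure α} [IsProbabilityMeasure P] {F : ℝ → α → ℝ}
    {g : α → ℝ} {K : ℝ} (hK : 0 ≤ K) (hg : Integrable g P)
    (hF : ∀ γ, ∫⁻ x, ENNReal.ofReal (Real.exp (-F γ x)) ∂P = 1)
    (hFg : ∀ γ, ∀ᵐ x ∂P, F γ x ≤ γ * g x + K * γ ^ 2 / 2) (γ : ℝ) :
    ∫ x, F γ x ∂P ≤ K * γ ^ 2 / 2 := by
  have hlin : ∀ γ : ℝ, -(γ * ∫ x, g x ∂P) ≤ K * γ ^ 2 / 2 := by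
    intro γ
    have hi : Integrable (fun x => (1 - K * γ ^ 2 / 2) - γ * g x) P :=
      (integrable_const _).sub (hg.const_mul γ)
    have h1 : ∫ x, ((1 - K * γ ^ 2 / 2) - γ * g x) ∂P ≤ 1 := by
      have h2 : ∫⁻ x, ENNReal.ofReal ((1 - K * γ ^ 2 / 2) - γ * g x) ∂P ≤ 1 := by
        rw [← hF γ]
        refine lintegral_mono_ae ?_
        filter_upwards [hFg γ] with x hx
        refine ENNReal.ofReal_le_ofReal ?_
        have := Real.add_one_le_exp (-F γ x)
        linarith
      rw [integral_eq_lintegral_pos_part_sub_lintegral_neg_part hi]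
      have h3 := ENNReal.toReal_mono ENNReal.one_ne_top h2
      rw [ENNReal.toReal_one] at h3
      linarith [ENNReal.toReal_nonneg
        (a := ∫⁻ x, ENNReal.ofReal (-((1 - K * γ ^ 2 / 2) - γ * g x)) ∂P)]
    rw [integral_sub (integrable_const _) (hg.const_mul γ), integral_const_mul] at h1
    simp at h1
    linarith
  have hzero : ∫ x, g x ∂P = 0 := by
    set m := ∫ x, g x ∂P
    have h := hlin (-m / (K + 1))
    have hK1 : 0 < K + 1 := by linarith
    have e1 : -(-m / (K + 1) * m) = m ^ 2 / (K + 1) := by ring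
    have e2 : K * (-m / (K + 1)) ^ 2 / 2 = K / (K + 1) * (m ^ 2 / (K + 1)) / 2 := by
      field_simp
    rw [e1, e2] at h
    have h4 : K / (K + 1) ≤ 1 := by rw [div_le_one hK1]; linarith
    have h5 : 0 ≤ m ^ 2 / (K + 1) := by positivity
    have h6 : m ^ 2 / (K + 1) = 0 := by nlinarith
    rcases div_eq_zero_iff.1 h6 with h7 | h7
    · exact pow_eq_zero_iff two_ne_zero |>.1 h7
    · linarith
  by_cases hi : Integrable (F γ) P
  · calc ∫ x, F γ x ∂P ≤ ∫ x, (γ * g x + K * γ ^ 2 / 2) ∂P :=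
          integral_mono_ae hi ((hg.const_mul γ).add (integrable_const _)) (hFg γ)
      _ = K * γ ^ 2 / 2 := by
          rw [integral_add (hg.const_mul γ) (integrable_const _), integral_const_mul, hzero]
          simp
  · rw [integral_undef hi]
    positivity

end GibbsFlow

section Reference

lemma measurePreserving_const_mul_logMeasure {c : ℝ} (hc : 0 < c) :
    MeasurePreserving (fun x => c * x) logMeasure logMeasure := by
  refine ⟨by fun_prop, ?_⟩
  ext s hs
  have hmul : Measurable fun x : ℝ => c * x := by fun_prop
  rw [Measure.map_apply hmul hs, logMeasure, withDensity_apply _ (hmul hs), withDensity_apply _ hs,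
    Measure.restrict_restrict (hmul hs), Measure.restrict_restrict hs]
  have hpre : (fun x : ℝ => c * x) ⁻¹' (s ∩ Set.Ioi 0) = (fun x => c * x) ⁻¹' s ∩ Set.Ioi 0 := by
    ext x
    simp [hc]
  rw [← hpre]
  conv_rhs => rw [← Real.smul_map_volume_mul_left hc.ne']
  rw [Measure.restrict_smul, lintegral_smul_measure,
    setLIntegral_map (hs.inter measurableSet_Ioi) (by fun_prop) hmul,
    abs_of_pos hc, smul_eq_mul, ← lintegral_const_mul _ (by fun_prop)]
  refine setLIntegral_congr_fun (hmul (hs.inter measurableSet_Ioi)) fun x _ => ?_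
  rw [← ENNReal.ofReal_mul hc.le]
  congr 1
  field_simp

instance sigmaFinite_logMeasure : SigmaFinite logMeasure := by
  unfold logMeasure
  infer_instance

variable {V : Type*} [DecidableEq V] (G : SimpleGraph V) (e₀ : G.edgeSet)
  (φ : Sym2 V → ℝ) (γ : ℝ)

instance sigmaFinite_dirac_or_logMeasure (e : G.edgeSet) :
    SigmaFinite (if e = e₀ then Measure.dirac (1 : ℝ) else logMeasure) := by
  split_ifs <;> infer_instance

lemma ae_rho_pos [Fintype G.edgeSet] : ∀ᵐ x ∂rho G e₀, ∀ e, 0 < x e := by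
  rw [ae_all_iff]
  intro e
  have h : ∀ᵐ t ∂(if e = e₀ then Measure.dirac (1 : ℝ) else logMeasure), 0 < t := by
    split_ifs
    · rw [ae_dirac_iff measurableSet_Ioi]
      exact one_pos
    · exact (withDensity_absolutelyContinuous _ _).ae_le (ae_restrict_mem measurableSet_Ioi)
  exact (Measure.quasiMeasurePreserving_eval
    (μ := fun e => if e = e₀ then Measure.dirac (1 : ℝ) else logMeasure) e).ae h

lemma measurePreserving_Xi [Fintype G.edgeSet] (h₀ : φ e₀ = 0) :
    MeasurePreserving (Xi G φ γ) (rho G e₀) (rho G e₀) := by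
  refine measurePreserving_pi _ _ fun e => ?_
  split_ifs with h
  · subst h
    convert MeasurePreserving.id (Measure.dirac (1 : ℝ)) using 1
    ext t
    simp [h₀]
  · exact measurePreserving_const_mul_logMeasure (Real.exp_pos _)

end Reference

section Weights

variable {V : Type*} (G : SimpleGraph V)

lemma Xi_neg_Xi (φ : Sym2 V → ℝ) (γ : ℝ) (x : G.edgeSet → ℝ) : Xi G φ (-γ) (Xi G φ γ x) = x := by
  ext e
  simp only [Xi]
  rw [← mul_assoc, ← Real.exp_add]
  simp

@[fun_prop]
lemma measurable_vwt [DecidableEq V] [Fintype G.edgeSet] (v : V) :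
    Measurable fun x => vwt G x v := by
  unfold vwt
  refine Finset.measurable_sum _ fun e _ => ?_
  split_ifs <;> fun_prop

@[fun_prop]
lemma measurable_treeSum [Fintype G.edgeSet] : Measurable (treeSum G) := by
  unfold treeSum
  refine Finset.measurable_sum _ fun T _ => ?_
  split_ifs <;> fun_prop

lemma exists_isSpanningTree [Fintype G.edgeSet] (hG : G.Connected) : ∃ T, IsSpanningTree G T := by
  obtain ⟨H, hle, hH⟩ := hG.exists_isTree_le
  refine ⟨Finset.univ.filter fun e => (e : Sym2 V) ∈ H.edgeSet, ?_⟩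
  have himage : Subtype.val '' ((Finset.univ.filter fun e : G.edgeSet =>
      (e : Sym2 V) ∈ H.edgeSet : Finset G.edgeSet) : Set G.edgeSet) = H.edgeSet := by
    ext e
    simp only [Finset.coe_filter, Finset.mem_univ, true_and, Set.mem_image, Set.mem_ofPred_eq,
      Subtype.exists, exists_and_left, exists_prop, exists_eq_right_right, and_iff_left_iff_imp]
    exact fun he => SimpleGraph.edgeSet_mono hle he
  rw [IsSpanningTree, himage, SimpleGraph.fromEdgeSet_edgeSet]
  exact hH

variable {G} in
lemma vertex_summand_nonneg [DecidableEq V] {x : G.edgeSet → ℝ} (hx : ∀ e, 0 < x e)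
    (v : V) (e : G.edgeSet) :
    0 ≤ if v ∈ (e : Sym2 V) then x e else 0 := by
  split_ifs
  exacts [(hx e).le, le_rfl]

variable {G} in
lemma tree_summand_nonneg {x : G.edgeSet → ℝ} (hx : ∀ e, 0 < x e) (T : Finset G.edgeSet) :
    0 ≤ if IsSpanningTree G T then ∏ e ∈ T, x e else 0 := by
  split_ifs
  exacts [Finset.prod_nonneg fun e _ => (hx e).le, le_rfl]

variable {x : G.edgeSet → ℝ}

lemma vwt_pos [DecidableEq V] [Nontrivial V] [Fintype G.edgeSet] (hG : G.Connected)
    (hx : ∀ e, 0 < x e) (v : V) : 0 < vwt G x v := by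
  obtain ⟨u, hu⟩ := hG.preconnected.exists_adj_of_nontrivial v
  refine Finset.sum_pos' (fun e _ => vertex_summand_nonneg hx v e)
    ⟨⟨s(v, u), hu⟩, Finset.mem_univ _, ?_⟩
  simpa using hx _

lemma treeSum_pos [Fintype G.edgeSet] (hG : G.Connected) (hx : ∀ e, 0 < x e) : 0 < treeSum G x := by
  obtain ⟨T, hT⟩ := exists_isSpanningTree G hG
  refine Finset.sum_pos' (fun S _ => tree_summand_nonneg hx S) ⟨T, Finset.mem_univ _, ?_⟩
  rw [if_pos hT]
  exact Finset.prod_pos fun e _ => hx e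

lemma vwt_Xi [DecidableEq V] [Fintype G.edgeSet] (φ : Sym2 V → ℝ) (γ : ℝ)
    (x : G.edgeSet → ℝ) (v : V) :
    vwt G (Xi G φ γ x) v =
      ∑ e : G.edgeSet, (if v ∈ (e : Sym2 V) then x e else 0) * Real.exp (γ * φ e) := by
  refine Finset.sum_congr rfl fun e _ => ?_
  split_ifs
  · exact mul_comm _ _
  · simp

lemma treeSum_Xi [Fintype G.edgeSet] (φ : Sym2 V → ℝ) (γ : ℝ) (x : G.edgeSet → ℝ) :
    treeSum G (Xi G φ γ x) = ∑ T : Finset G.edgeSet,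
      (if IsSpanningTree G T then ∏ e ∈ T, x e else 0) * Real.exp (γ * Delta G φ T) := by
  refine Finset.sum_congr rfl fun T _ => ?_
  split_ifs
  · simp only [Xi, Finset.prod_mul_distrib, ← Real.exp_sum, ← Finset.mul_sum, Delta]
    exact mul_comm _ _
  · simp

lemma maxsq_nonneg (φ : Sym2 V → ℝ) (v : V) : 0 ≤ maxsq G φ v := by
  refine Real.sSup_nonneg ?_
  rintro _ ⟨p, -, rfl⟩
  exact sq_nonneg _

lemma sq_sub_le_maxsq [Finite G.edgeSet] (φ : Sym2 V → ℝ) {v : V} {e e' : G.edgeSet}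
    (he : v ∈ (e : Sym2 V)) (he' : v ∈ (e' : Sym2 V)) : (φ e - φ e') ^ 2 ≤ maxsq G φ v :=
  le_csSup (Set.toFinite _).bddAbove ⟨(e, e'), ⟨he, he'⟩, rfl⟩

lemma avwt_nonneg [DecidableEq V] [Fintype G.edgeSet] {a : Sym2 V → ℝ}
    (ha : ∀ e ∈ G.edgeSet, 0 < a e) (v : V) : 0 ≤ avwt G a v := by
  refine Finset.sum_nonneg fun e _ => ?_
  split_ifs
  exacts [(ha e e.2).le, le_rfl]

lemma Sphi_nonneg [Fintype V] [DecidableEq V] [Fintype G.edgeSet] {a : Sym2 V → ℝ}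
    (ha : ∀ e ∈ G.edgeSet, 0 < a e) (φ : Sym2 V → ℝ) :
    0 ≤ Sphi G a φ :=
  Finset.sum_nonneg fun v _ =>
    mul_nonneg (by linarith [avwt_nonneg G ha v]) (maxsq_nonneg G φ v)

end Weights

noncomputable section LogDensity

variable {V : Type*} [Fintype V] [DecidableEq V] (G : SimpleGraph V) [Fintype G.edgeSet]
  (a : Sym2 V → ℝ) (c : V → ℝ) (φ : Sym2 V → ℝ) (γ : ℝ)

/-- The logarithm of `∏ x_e^{a_e} ∏ x_v^{-c_v} √(∑_T ∏_{e ∈ T} x_e)`. -/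
def logWeight (x : G.edgeSet → ℝ) : ℝ :=
  ∑ e : G.edgeSet, a e * Real.log (x e) - ∑ v, c v * Real.log (vwt G x v) +
    1 / 2 * Real.log (treeSum G x)

/-- The derivative at `γ = 0` of `logWeight G a c x - logWeight G a c (Xi G φ γ x)`. -/
def score (x : G.edgeSet → ℝ) : ℝ :=
  -∑ e : G.edgeSet, a e * φ e +
    ∑ v, c v * weightedMean (fun e : G.edgeSet => if v ∈ (e : Sym2 V) then x e else 0)
      (fun e => φ e) -
    1 / 2 * weightedMean (fun T => if IsSpanningTree G T then ∏ e ∈ T, x e else 0) (Delta G φ)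

/-- The exponents of the vertex weights in `Phi`, up to sign. -/
def vertexExponent (v₀ v : V) : ℝ := if v = v₀ then avwt G a v / 2 else (avwt G a v + 1) / 2

@[fun_prop]
lemma measurable_logWeight : Measurable (logWeight G a c) := by
  unfold logWeight
  fun_prop

lemma measurable_score : Measurable (score G a c φ) := by
  unfold score weightedMean
  have h1 (v : V) (e : G.edgeSet) :
      Measurable fun x : G.edgeSet → ℝ => if v ∈ (e : Sym2 V) then x e else 0 := by
    split_ifs <;> fun_prop
  have h2 (T : Finset G.edgeSet) :
      Measurable fun x : G.edgeSet → ℝ => if IsSpanningTree G T then ∏ e ∈ T, x e else 0 := by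
    split_ifs <;> fun_prop
  fun_prop

variable {G a c} {x : G.edgeSet → ℝ}

lemma exists_abs_score_le :
    ∃ C, ∀ x : G.edgeSet → ℝ, (∀ e, 0 < x e) → |score G a c φ x| ≤ C := by
  refine ⟨|∑ e : G.edgeSet, a e * φ e| + ∑ v, |c v| * ∑ e : G.edgeSet, |φ e| +
    1 / 2 * ∑ T, |Delta G φ T|, fun x hx => ?_⟩
  refine (abs_sub _ _).trans (add_le_add ((abs_add_le _ _).trans (add_le_add ?_ ?_)) ?_)
  · rw [abs_neg]
  · refine (Finset.abs_sum_le_sum_abs _ _).trans (Finset.sum_le_sum fun v _ => ?_)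
    rw [abs_mul]
    exact mul_le_mul_of_nonneg_left
      (abs_weightedMean_le _ (vertex_summand_nonneg hx v)) (abs_nonneg _)
  · rw [abs_mul, abs_of_pos (by norm_num : (0 : ℝ) < 1 / 2)]
    exact mul_le_mul_of_nonneg_left (abs_weightedMean_le _ (tree_summand_nonneg hx)) (by norm_num)

/-- The quadratic upper bound for the logarithm of the density of the deformed measure. -/
lemma logWeight_sub_le [Nontrivial V] (hG : G.Connected) (hc : ∀ v, 0 ≤ c v)
    (hca : ∀ v, c v ≤ (avwt G a v + 1) / 2) (hx : ∀ e, 0 < x e) :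
    logWeight G a c x - logWeight G a c (Xi G φ γ x) ≤
      γ * score G a c φ x + Sphi G a φ * γ ^ 2 / 2 := by
  have hedge : ∑ e : G.edgeSet, a e * Real.log (Xi G φ γ x e) =
      ∑ e : G.edgeSet, a e * Real.log (x e) + γ * ∑ e : G.edgeSet, a e * φ e := by
    rw [Finset.mul_sum, ← Finset.sum_add_distrib]
    refine Finset.sum_congr rfl fun e _ => ?_
    rw [Xi, Real.log_mul (Real.exp_pos _).ne' (hx e).ne', Real.log_exp]
    ring
  have hvertex : ∑ v, c v * Real.log (vwt G (Xi G φ γ x) v) ≤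
      ∑ v, c v * Real.log (vwt G x v) +
        γ * ∑ v, c v * weightedMean (fun e : G.edgeSet => if v ∈ (e : Sym2 V) then x e else 0)
          (fun e => φ e) + Sphi G a φ * γ ^ 2 / 2 := by
    rw [Sphi, Finset.sum_mul, Finset.sum_div, Finset.mul_sum, ← Finset.sum_add_distrib,
      ← Finset.sum_add_distrib]
    refine Finset.sum_le_sum fun v _ => ?_
    have h := log_le_mul_weightedMean_add (fun e : G.edgeSet => φ e) γ
      (vertex_summand_nonneg hx v) (vwt_pos G hG hx v) (D := maxsq G φ v)
      fun e e' he he' => sq_sub_le_maxsq G φ (by by_contra h; simp [h] at he)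
        (by by_contra h; simp [h] at he')
    rw [← vwt_Xi] at h
    have h1 := mul_le_mul_of_nonneg_left h (hc v)
    have h2 := mul_le_mul_of_nonneg_right (hca v)
      (mul_nonneg (maxsq_nonneg G φ v) (sq_nonneg γ))
    change c v * (_ - Real.log (vwt G x v)) ≤ _ at h1
    linarith
  have htree := mul_weightedMean_le_log (Delta G φ) γ (tree_summand_nonneg hx)
    (treeSum_pos G hG hx)
  rw [← treeSum_Xi] at htree
  change _ ≤ _ - Real.log (treeSum G x) at htree
  unfold logWeight score
  rw [hedge]
  linarith

lemma Phi_eq_exp_logWeight [Nontrivial V] (hG : G.Connected) (hx : ∀ e, 0 < x e) (v₀ : V) :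
    Phi G a v₀ x = Real.exp (logWeight G a (vertexExponent G a v₀) x) := by
  have hedge : ∏ e : G.edgeSet, x e ^ a e = Real.exp (∑ e : G.edgeSet, a e * Real.log (x e)) := by
    rw [Real.exp_sum]
    refine Finset.prod_congr rfl fun e _ => ?_
    rw [Real.rpow_def_of_pos (hx e), mul_comm]
  have hvertex : vwt G x v₀ ^ (-avwt G a v₀ / 2) *
      ∏ v ∈ Finset.univ.erase v₀, vwt G x v ^ (-(avwt G a v + 1) / 2) =
      Real.exp (-∑ v, vertexExponent G a v₀ v * Real.log (vwt G x v)) := by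
    rw [← Finset.sum_neg_distrib, Real.exp_sum, ← Finset.mul_prod_erase _ _ (Finset.mem_univ v₀)]
    congr 1
    · rw [Real.rpow_def_of_pos (vwt_pos G hG hx v₀), vertexExponent, if_pos rfl]
      congr 1; ring
    · refine Finset.prod_congr rfl fun v hv => ?_
      rw [Real.rpow_def_of_pos (vwt_pos G hG hx v), vertexExponent,
        if_neg (Finset.ne_of_mem_erase hv)]
      congr 1; ring
  have htree : Real.sqrt (treeSum G x) = Real.exp (1 / 2 * Real.log (treeSum G x)) := by
    rw [Real.sqrt_eq_rpow, Real.rpow_def_of_pos (treeSum_pos G hG hx), mul_comm]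
  rw [Phi, mul_assoc (∏ e : G.edgeSet, x e ^ a e), hvertex, hedge, htree, ← Real.exp_add,
    ← Real.exp_add, logWeight, sub_eq_add_neg]

lemma measurable_Phi (v₀ : V) : Measurable (Phi G a v₀) := by
  unfold Phi
  fun_prop

lemma logWeight_add_div_two (c c' : V → ℝ) (x : G.edgeSet → ℝ) :
    logWeight G a (fun v => (c v + c' v) / 2) x =
      (logWeight G a c x + logWeight G a c' x) / 2 := by
  have h : ∑ v, (c v + c' v) / 2 * Real.log (vwt G x v) =
      (∑ v, c v * Real.log (vwt G x v) + ∑ v, c' v * Real.log (vwt G x v)) / 2 := by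
    rw [← Finset.sum_add_distrib, Finset.sum_div]
    exact Finset.sum_congr rfl fun v _ => by ring
  simp only [logWeight, h]
  ring

end LogDensity

section Interpolation

variable {V : Type*} [Fintype V] [DecidableEq V] {G : SimpleGraph V} [Fintype G.edgeSet]
  {a : Sym2 V → ℝ} {v₀ v₁ : V} {e₀ : G.edgeSet}

lemma Pm_eq_zero_of_ae (h : interpDens G a v₀ v₁ e₀ =ᵐ[rho G e₀] 0) : Pm G a v₀ v₁ e₀ = 0 := by
  rw [Pm, withDensity_congr_ae h, withDensity_zero, smul_zero]

lemma ae_Phi_eq_zero {v : V} (h : z G a v e₀ = 0) :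
    ∀ᵐ x ∂rho G e₀, ENNReal.ofReal (Phi G a v x) = 0 :=
  (lintegral_eq_zero_iff (measurable_Phi v).ennreal_ofReal).1 h

lemma interpDens_eq [Nontrivial V] (hG : G.Connected) (hz0 : z G a v₀ e₀ ≠ ⊤)
    (hz1 : z G a v₁ e₀ ≠ ⊤) (hz0' : z G a v₀ e₀ ≠ 0) (hz1' : z G a v₁ e₀ ≠ 0)
    {x : G.edgeSet → ℝ} (hx : ∀ e, 0 < x e) :
    interpDens G a v₀ v₁ e₀ x = ENNReal.ofReal (Real.exp
      (logWeight G a (fun v => (vertexExponent G a v₀ v + vertexExponent G a v₁ v) / 2) x -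
        (Real.log (z G a v₀ e₀).toReal + Real.log (z G a v₁ e₀).toReal) / 2)) := by
  have hfactor {v : V} (h : z G a v e₀ ≠ ⊤) (h' : z G a v e₀ ≠ 0) :
      ENNReal.ofReal (Phi G a v x) / z G a v e₀ = ENNReal.ofReal (Real.exp
        (logWeight G a (vertexExponent G a v) x - Real.log (z G a v e₀).toReal)) := by
    have hpos := ENNReal.toReal_pos h' h
    rw [Real.exp_sub, Real.exp_log hpos, ENNReal.ofReal_div_of_pos hpos, ENNReal.ofReal_toReal h,
      Phi_eq_exp_logWeight hG hx]
  rw [interpDens, hfactor hz0 hz0', hfactor hz1 hz1', ← ENNReal.ofReal_mul (Real.exp_pos _).le,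
    ← Real.exp_add, ENNReal.ofReal_rpow_of_pos (Real.exp_pos _), ← Real.exp_mul,
    logWeight_add_div_two]
  congr 2; ring

/-- The interpolated measure is either trivial or a Gibbs probability measure. -/
lemma Pm_eq_zero_or [Nontrivial V] (hG : G.Connected) (hz0 : z G a v₀ e₀ ≠ ⊤)
    (hz1 : z G a v₁ e₀ ≠ ⊤) :
    Pm G a v₀ v₁ e₀ = 0 ∨ IsProbabilityMeasure (Pm G a v₀ v₁ e₀) ∧
      ∃ k, Pm G a v₀ v₁ e₀ = (rho G e₀).withDensity fun x => ENNReal.ofReal (Real.exp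
        (logWeight G a (fun v => (vertexExponent G a v₀ v + vertexExponent G a v₁ v) / 2) x -
          k)) := by
  rcases eq_or_ne (z G a v₀ e₀) 0 with hz0' | hz0'
  · left
    refine Pm_eq_zero_of_ae ?_
    filter_upwards [ae_Phi_eq_zero hz0'] with x hx
    simp [interpDens, hx]
  rcases eq_or_ne (z G a v₁ e₀) 0 with hz1' | hz1'
  · left
    refine Pm_eq_zero_of_ae ?_
    filter_upwards [ae_Phi_eq_zero hz1'] with x hx
    simp [interpDens, hx]
  set k := (Real.log (z G a v₀ e₀).toReal + Real.log (z G a v₁ e₀).toReal) / 2 with hk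
  have hdens : interpDens G a v₀ v₁ e₀ =ᵐ[rho G e₀] fun x => ENNReal.ofReal (Real.exp
      (logWeight G a (fun v => (vertexExponent G a v₀ v + vertexExponent G a v₁ v) / 2) x -
        k)) := by
    filter_upwards [ae_rho_pos G e₀] with x hx
    exact interpDens_eq hG hz0 hz1 hz0' hz1' hx
  have hmass : (rho G e₀).withDensity (interpDens G a v₀ v₁ e₀) Set.univ = Zc G a v₀ v₁ e₀ := by
    rw [withDensity_apply _ MeasurableSet.univ, Measure.restrict_univ, Zc]
  rcases eq_or_ne (Zc G a v₀ v₁ e₀) 0 with hZ | hZ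
  · left
    rw [Pm, Measure.measure_univ_eq_zero.1 (hmass.trans hZ), smul_zero]
  rcases eq_or_ne (Zc G a v₀ v₁ e₀) ⊤ with hZt | hZt
  · left
    rw [Pm, hZt, ENNReal.inv_top, zero_smul]
  right
  refine ⟨⟨?_⟩, k + Real.log (Zc G a v₀ v₁ e₀).toReal, ?_⟩
  · rw [Pm, Measure.smul_apply, hmass, smul_eq_mul, ENNReal.inv_mul_cancel hZ hZt]
  · have hpos := ENNReal.toReal_pos hZ hZt
    rw [Pm, withDensity_congr_ae hdens, ← withDensity_smul _ (by fun_prop)]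
    congr 1
    ext x
    rw [Pi.smul_apply, ← sub_sub, Real.exp_sub _ (Real.log _), Real.exp_log hpos,
      ENNReal.ofReal_div_of_pos hpos, ENNReal.ofReal_toReal hZt, smul_eq_mul, mul_comm,
      ENNReal.div_eq_inv_mul, mul_comm]

end Interpolation

end ERRWGraph

open ERRWGraph in
/-- Lemma 6.1 (Bound of the relative entropy): under Assumption 2.3, for every
`γ ∈ ℝ`, `E_{Π^{γφ}}[log(dΠ^{γφ}/dℙ_{v₀,v₁,e₀})] ≤ S_φ γ²/2`. -/
theorem entropy_bound {V : Type*} [Fintype V] [DecidableEq V]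
    (G : SimpleGraph V) [Fintype G.edgeSet] (hG : G.Connected)
    (a φ : Sym2 V → ℝ) (ha : ∀ e ∈ G.edgeSet, 0 < a e)
    (v₀ v₁ : V) (e₀ : G.edgeSet)
    (hass : Assumption23 G a φ v₀ v₁ e₀)
    (hz0 : z G a v₀ e₀ ≠ ⊤) (hz1 : z G a v₁ e₀ ≠ ⊤) (γ : ℝ) :
    (∫ x, logRN (PiGamma G a φ v₀ v₁ e₀ γ) (Pm G a v₀ v₁ e₀) x
        ∂PiGamma G a φ v₀ v₁ e₀ γ) ≤ Sphi G a φ * γ ^ 2 / 2 := by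
  obtain ⟨hne, -, hv₀, -, -, hφ₀, -⟩ := hass
  have : Nontrivial V := ⟨v₀, v₁, hne⟩
  rcases Pm_eq_zero_or hG hz0 hz1 with h | ⟨hprob, k, hP⟩
  · have hS := Sphi_nonneg G ha φ
    simp only [PiGamma, h, Measure.map_zero, integral_zero_measure]
    positivity
  set c : V → ℝ := fun v => (vertexExponent G a v₀ v + vertexExponent G a v₁ v) / 2 with hc
  have hexp (u v : V) : 0 ≤ vertexExponent G a u v ∧
      vertexExponent G a u v ≤ (avwt G a v + 1) / 2 := by
    have := avwt_nonneg G ha v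
    unfold vertexExponent
    split_ifs <;> constructor <;> linarith
  have hc0 (v : V) : 0 ≤ c v := by
    simp only [hc]
    linarith [(hexp v₀ v).1, (hexp v₁ v).1]
  have hca (v : V) : c v ≤ (avwt G a v + 1) / 2 := by
    simp only [hc]
    linarith [(hexp v₀ v).2, (hexp v₁ v).2]
  have hpos : ∀ᵐ x ∂Pm G a v₀ v₁ e₀, ∀ e, 0 < x e := by
    rw [hP]
    exact (withDensity_absolutelyContinuous _ _).ae_le (ae_rho_pos G e₀)
  have hL : Measurable fun x => logWeight G a c x - k := by fun_prop
  have hXi (t : ℝ) := measurePreserving_Xi G e₀ φ t (hφ₀ e₀ hv₀)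
  have hscore : Integrable (score G a c φ) (Pm G a v₀ v₁ e₀) := by
    obtain ⟨C, hC⟩ := exists_abs_score_le (G := G) (a := a) (c := c) φ
    refine Integrable.of_bound (measurable_score G a c φ).aestronglyMeasurable C ?_
    filter_upwards [hpos] with x hx using hC x hx
  refine (integral_log_rnDeriv_map_exp hP hL (hXi γ) (hXi (-γ)).measurable
    (Xi_neg_Xi G φ γ)).trans_le ?_
  refine integral_le_of_quadratic_bound
    (F := fun t x => (logWeight G a c x - k) - (logWeight G a c (Xi G φ t x) - k))
    (Sphi_nonneg G ha φ) hscore (fun t => ?_) (fun t => ?_) γ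
  · simp_rw [neg_sub]
    exact lintegral_exp_sub_eq_one hP hL (hXi t)
  · filter_upwards [hpos] with x hx
    linarith [logWeight_sub_le φ t hG hc0 hca hx]
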